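/- Let H be a real inner product space, K ⊆ H a convex subset, b ∈ H, and A : H × H → ℝ a symmetric bilinear form with A(v, v) ≥ α‖v‖² for all v ∈ H and some α > 0. Let d be the infimum of the quadratic functional I(z) = A(z, z) − 2⟨b, z⟩ over K. If x, y ∈ K satisfy I(x) ≤ d + δ₁ and I(y) ≤ d + δ₂ for some δ₁, δ₂ ≥ 0, then α‖x − y‖² ≤ 2(δ₁ + δ₂). In particular, every minimizing sequence for I on K is a Cauchy sequence. -/

import Mathlib

open scoped InnerProductSpace

/-- Minimizing sequences of the quadratic functional `I(z) = A(z,z) − 2⟨b,z⟩`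
over a convex set `K` are Cauchy: if `I(x) ≤ d + δ₁` and `I(y) ≤ d + δ₂` with
`d = inf_K I`, then `α‖x − y‖² ≤ 2(δ₁ + δ₂)`. -/
theorem stmt_6 {H : Type*} [NormedAddCommGroup H] [InnerProductSpace ℝ H]
    (K : Set H) (hK_cv : Convex ℝ K)
    (A : H →ₗ[ℝ] H →ₗ[ℝ] ℝ) (hA_symm : ∀ v w : H, A v w = A w v)
    (α : ℝ) (hα : 0 < α) (hcoer : ∀ v : H, α * ‖v‖ ^ 2 ≤ A v v)
    (b : H) (d : ℝ)
    (hd : d = sInf ((fun z : H => A z z - 2 * ⟪b, z⟫_ℝ) '' K))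
    (x y : H) (hx : x ∈ K) (hy : y ∈ K)
    (δ₁ δ₂ : ℝ) (hδ₁ : 0 ≤ δ₁) (hδ₂ : 0 ≤ δ₂)
    (hIx : A x x - 2 * ⟪b, x⟫_ℝ ≤ d + δ₁)
    (hIy : A y y - 2 * ⟪b, y⟫_ℝ ≤ d + δ₂) :
    α * ‖x - y‖ ^ 2 ≤ 2 * (δ₁ + δ₂) := by
  have hbdd : BddBelow ((fun z : H => A z z - 2 * ⟪b, z⟫_ℝ) '' K) := by
    refine ⟨-(‖b‖ ^ 2 / α), ?_⟩
    rintro _ ⟨z, _, rfl⟩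
    have h1 := hcoer z
    have h2 := real_inner_le_norm b z
    have h3 : 0 ≤ (α * ‖z‖ - ‖b‖) ^ 2 / α := by positivity
    have h4 : (α * ‖z‖ - ‖b‖) ^ 2 / α
        = α * ‖z‖ ^ 2 - 2 * (‖b‖ * ‖z‖) + ‖b‖ ^ 2 / α := by
      field_simp
      ring
    simp only
    linarith
  have hm : (1 / 2 : ℝ) • x + (1 / 2 : ℝ) • y ∈ K :=
    hK_cv hx hy (by norm_num) (by norm_num) (by norm_num)
  have hle := csInf_le hbdd (Set.mem_image_of_mem _ hm)
  rw [← hd] at hle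
  have hc := hcoer (x - y)
  have hs := hA_symm x y
  simp only [map_add, map_sub, map_smul, LinearMap.add_apply, LinearMap.sub_apply,
    LinearMap.smul_apply, smul_eq_mul, inner_add_right, inner_smul_right] at hle hc
  linarith
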